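/- arXiv:2109.10676 — 5 statements merged into one kernel-verified Lean document; each statement's English description precedes it below -/
import Mathlib

section
/- Proposition 1(a): If q ∈ ℝⁿ satisfies F q = 0 (all r zero restrictions) and S q ≥ 0 componentwise (all s sign restrictions), then the vector q̄ = M Kᵀ q ∈ ℝ^{n−r} (the first n−r coordinates of Kᵀ q) satisfies S̄ q̄ ≥ 0 componentwise. -/
open Matrix RealInnerProductSpace

/-- The `(n-r) × n` matrix `M = (I_{n-r} | 0)` selecting the first `n - r` coordinates. -/
noncomputable def selM (n r : ℕ) : Matrix (Fin (n - r)) (Fin n) ℝ :=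
  Matrix.of fun i j => if (j : ℕ) = (i : ℕ) then 1 else 0

theorem selM_transpose_mulVec_selM_mulVec {n r : ℕ} {v : Fin n → ℝ}
    (hv : ∀ i : Fin n, n - r ≤ (i : ℕ) → v i = 0) :
    (selM n r)ᵀ *ᵥ (selM n r *ᵥ v) = v := by
  have hM : ∀ j : Fin (n - r), (selM n r *ᵥ v) j = v (Fin.castLE (Nat.sub_le n r) j) := by
    intro j
    rw [mulVec, dotProduct, Finset.sum_eq_single (Fin.castLE (Nat.sub_le n r) j)]
    · simp [selM]
    · intro k _ hk
      have : (k : ℕ) ≠ j := fun h => hk (Fin.ext h)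
      simp [selM, this]
    · simp
  ext i
  rw [mulVec, dotProduct]
  by_cases hi : (i : ℕ) < n - r
  · rw [Finset.sum_eq_single ⟨i, hi⟩]
    · rw [hM]
      simp [selM]
    · intro k _ hk
      have : (i : ℕ) ≠ k := fun h => hk (Fin.ext h.symm)
      simp [selM, this]
    · simp
  · rw [hv i (not_lt.mp hi)]
    refine Finset.sum_eq_zero fun k _ => ?_
    have : (i : ℕ) ≠ k := by omega
    simp [selM, this]

theorem transpose_mulVec_apply_eq_zero_of_mem_span {n m : ℕ} (hmn : m ≤ n)
    {K : Matrix (Fin n) (Fin n) ℝ} (hK : Kᵀ * K = 1) {x : Fin n → ℝ}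
    (hx : x ∈ Submodule.span ℝ (Set.range fun j : Fin m => Kᵀ (Fin.castLE hmn j)))
    {i : Fin n} (hi : m ≤ (i : ℕ)) : (Kᵀ *ᵥ x) i = 0 := by
  induction hx using Submodule.span_induction with
  | mem x hx =>
    obtain ⟨j, rfl⟩ := hx
    have hne : i ≠ Fin.castLE hmn j := by
      rintro rfl
      have := j.isLt
      simp at hi
      omega
    have h := congrFun (congrFun hK i) (Fin.castLE hmn j)
    rw [one_apply_ne hne] at h
    exact h
  | zero => simp
  | add x y _ _ hx hy => rw [mulVec_add, Pi.add_apply, hx, hy, add_zero]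
  | smul a x _ hx => rw [mulVec_smul, Pi.smul_apply, hx, smul_zero]

/-- Proposition 1(a): if `q ∈ ℝⁿ` satisfies the zero restrictions `F q = 0` and the sign
restrictions `S q ≥ 0`, then `q̄ = M Kᵀ q ∈ ℝ^{n-r}` satisfies `S̄ q̄ ≥ 0`, where
`S̄ = S K (Iₙ - F̃ᵀ (F̃ F̃ᵀ)⁻¹ F̃) Mᵀ` with `F̃ = F K`. -/
theorem prop1a (n r s : ℕ) (hr : 0 < r) (hrn : r < n)
    (F : Matrix (Fin r) (Fin n) ℝ) (S : Matrix (Fin s) (Fin n) ℝ)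
    (hF : F.rank = r)
    (K : Matrix (Fin n) (Fin n) ℝ) (hK : Kᵀ * K = 1)
    (hcol : ∀ j : Fin (n - r), F.mulVec (Kᵀ (Fin.castLE (Nat.sub_le n r) j)) = 0)
    (hspan : ∀ x : Fin n → ℝ, F.mulVec x = 0 →
      x ∈ Submodule.span ℝ (Set.range fun j : Fin (n - r) => Kᵀ (Fin.castLE (Nat.sub_le n r) j)))
    (q : Fin n → ℝ) (hq0 : F.mulVec q = 0) (hqS : ∀ i, 0 ≤ S.mulVec q i) :
    ∀ i, 0 ≤ ((S * K * (1 - (F * K)ᵀ * ((F * K) * (F * K)ᵀ)⁻¹ * (F * K)) * (selM n r)ᵀ).mulVec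
      ((selM n r).mulVec (Kᵀ.mulVec q))) i := by
  have hy := selM_transpose_mulVec_selM_mulVec (r := r) (v := Kᵀ *ᵥ q) fun i hi =>
    transpose_mulVec_apply_eq_zero_of_mem_span (Nat.sub_le n r) hK (hspan q hq0) hi
  have hKq : K *ᵥ (Kᵀ *ᵥ q) = q := by
    rw [mulVec_mulVec, mul_eq_one_comm.mp hK, one_mulVec]
  have hFq : (F * K) *ᵥ (Kᵀ *ᵥ q) = 0 := by
    rw [← mulVec_mulVec, hKq, hq0]
  rw [← mulVec_mulVec, hy, ← mulVec_mulVec, sub_mulVec, one_mulVec, ← mulVec_mulVec _ _ (F * K),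
    hFq, mulVec_zero, sub_zero, ← mulVec_mulVec, hKq]
  exact hqS
end

section
/- Proposition 1(b): If q̄ ∈ ℝ^{n−r} satisfies S̄ q̄ ≥ 0 componentwise, then the vector q = K Mᵀ q̄ ∈ ℝⁿ satisfies F q = 0 and S q ≥ 0 componentwise. -/
open Matrix RealInnerProductSpace

theorem mul_transpose_selM_eq_zero {n r m : ℕ} (F : Matrix (Fin m) (Fin n) ℝ)
    (K : Matrix (Fin n) (Fin n) ℝ)
    (hcol : ∀ j : Fin (n - r), F.mulVec (Kᵀ (Fin.castLE (Nat.sub_le n r) j)) = 0) :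
    F * K * (selM n r)ᵀ = 0 := by
  ext i j
  have hsel (k : Fin n) : (selM n r)ᵀ k j = if k = Fin.castLE (Nat.sub_le n r) j then 1 else 0 := by
    simp [selM, Fin.ext_iff]
  rw [Matrix.mul_apply]
  simp only [hsel, mul_ite, mul_one, mul_zero, Finset.sum_ite_eq', Finset.mem_univ, if_true]
  exact congrFun (hcol j) i

/-- Proposition 1(b): if `q̄ ∈ ℝ^{n-r}` satisfies `S̄ q̄ ≥ 0`, where
`S̄ = S K (Iₙ - F̃ᵀ (F̃ F̃ᵀ)⁻¹ F̃) Mᵀ` with `F̃ = F K`, then `q = K Mᵀ q̄ ∈ ℝⁿ` satisfies the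
zero restrictions `F q = 0` and the sign restrictions `S q ≥ 0`. -/
theorem prop1b (n r s : ℕ) (hr : 0 < r) (hrn : r < n)
    (F : Matrix (Fin r) (Fin n) ℝ) (S : Matrix (Fin s) (Fin n) ℝ)
    (hF : F.rank = r)
    (K : Matrix (Fin n) (Fin n) ℝ) (hK : Kᵀ * K = 1)
    (hcol : ∀ j : Fin (n - r), F.mulVec (Kᵀ (Fin.castLE (Nat.sub_le n r) j)) = 0)
    (hspan : ∀ x : Fin n → ℝ, F.mulVec x = 0 →
      x ∈ Submodule.span ℝ (Set.range fun j : Fin (n - r) => Kᵀ (Fin.castLE (Nat.sub_le n r) j)))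
    (qb : Fin (n - r) → ℝ)
    (hqb : ∀ i, 0 ≤ ((S * K * (1 - (F * K)ᵀ * ((F * K) * (F * K)ᵀ)⁻¹ * (F * K)) * (selM n r)ᵀ).mulVec
      qb) i) :
    F.mulVec (K.mulVec ((selM n r)ᵀ.mulVec qb)) = 0 ∧
      ∀ i, 0 ≤ S.mulVec (K.mulVec ((selM n r)ᵀ.mulVec qb)) i := by
  have hFKM := mul_transpose_selM_eq_zero F K hcol
  refine ⟨by rw [mulVec_mulVec, mulVec_mulVec, hFKM, zero_mulVec], fun i => ?_⟩
  have hproj : S * K * (1 - (F * K)ᵀ * ((F * K) * (F * K)ᵀ)⁻¹ * (F * K)) * (selM n r)ᵀ =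
      S * K * (selM n r)ᵀ := by
    rw [Matrix.mul_assoc (S * K), Matrix.sub_mul, Matrix.mul_assoc _ (F * K), hFKM,
      Matrix.mul_zero, sub_zero, Matrix.one_mul]
  rw [mulVec_mulVec, mulVec_mulVec, ← hproj]
  exact hqb i
end

section
/- Corollary 1: The set Q₁(F,S) = {q ∈ ℝⁿ : ‖q‖ = 1, F q = 0, S q ≥ 0} is nonempty if and only if the set Q̄₁(S̄) = {q̄ ∈ ℝ^{n−r} : ‖q̄‖ = 1, S̄ q̄ ≥ 0} is nonempty. -/
open Matrix RealInnerProductSpace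

theorem mul_selM_transpose (n r : ℕ) (K : Matrix (Fin n) (Fin n) ℝ) :
    K * (selM n r)ᵀ = K.submatrix id (Fin.castLE (Nat.sub_le n r)) := by
  ext i j
  rw [mul_apply, Finset.sum_eq_single (Fin.castLE (Nat.sub_le n r) j)]
  · simp [selM]
  · intro k _ hk
    have hkj : (k : ℕ) ≠ j := fun h => hk (Fin.ext h)
    simp [selM, hkj]
  · simp

theorem submatrix_transpose_mul_submatrix_eq_one {m n : Type*} [Fintype n] [DecidableEq n]
    [DecidableEq m] {K : Matrix n n ℝ} (hK : Kᵀ * K = 1) {f : m → n}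
    (hf : Function.Injective f) : (K.submatrix id f)ᵀ * K.submatrix id f = 1 := by
  rw [transpose_submatrix, ← submatrix_mul _ _ f id f Function.bijective_id, hK,
    submatrix_one f hf]

theorem norm_toLp_mulVec_of_transpose_mul_self {m n : Type*} [Fintype m] [Fintype n]
    [DecidableEq m] {A : Matrix n m ℝ} (hA : Aᵀ * A = 1) (x : EuclideanSpace ℝ m) :
    ‖WithLp.toLp 2 (A *ᵥ x)‖ = ‖x‖ := by
  have h : (A *ᵥ x.ofLp) ⬝ᵥ (A *ᵥ x.ofLp) = x.ofLp ⬝ᵥ x.ofLp := by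
    rw [dotProduct_mulVec, ← mulVec_transpose, mulVec_mulVec, hA, one_mulVec]
  simp only [EuclideanSpace.norm_eq, Real.norm_eq_abs, sq_abs]
  simpa [dotProduct, pow_two] using congrArg Real.sqrt h

/-- Corollary 1: the identified set
`Q₁(F,S) = {q ∈ ℝⁿ : ‖q‖ = 1, F q = 0, S q ≥ 0}` is nonempty if and only if
`Q̄₁(S̄) = {q̄ ∈ ℝ^{n-r} : ‖q̄‖ = 1, S̄ q̄ ≥ 0}` is nonempty, where
`S̄ = S K (Iₙ - F̃ᵀ (F̃ F̃ᵀ)⁻¹ F̃) Mᵀ` with `F̃ = F K`. -/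
theorem cor1 (n r s : ℕ) (hr : 0 < r) (hrn : r < n)
    (F : Matrix (Fin r) (Fin n) ℝ) (S : Matrix (Fin s) (Fin n) ℝ)
    (hF : F.rank = r)
    (K : Matrix (Fin n) (Fin n) ℝ) (hK : Kᵀ * K = 1)
    (hcol : ∀ j : Fin (n - r), F.mulVec (Kᵀ (Fin.castLE (Nat.sub_le n r) j)) = 0)
    (hspan : ∀ x : Fin n → ℝ, F.mulVec x = 0 →
      x ∈ Submodule.span ℝ (Set.range fun j : Fin (n - r) => Kᵀ (Fin.castLE (Nat.sub_le n r) j))) :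
    (∃ q : EuclideanSpace ℝ (Fin n), ‖q‖ = 1 ∧ F.mulVec q = 0 ∧ ∀ i, 0 ≤ S.mulVec q i) ↔
    (∃ qb : EuclideanSpace ℝ (Fin (n - r)), ‖qb‖ = 1 ∧
      ∀ i, 0 ≤ ((S * K * (1 - (F * K)ᵀ * ((F * K) * (F * K)ᵀ)⁻¹ * (F * K)) * (selM n r)ᵀ).mulVec
        qb) i) := by
  set A : Matrix (Fin n) (Fin (n - r)) ℝ :=
    K.submatrix id (Fin.castLE (Nat.sub_le n r))
  have hKM : K * (selM n r)ᵀ = A := mul_selM_transpose n r K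
  have hA : Aᵀ * A = 1 :=
    submatrix_transpose_mul_submatrix_eq_one hK (Fin.castLE_injective _)
  have hFA : F * A = 0 := by
    ext i j
    exact congrFun (hcol j) i
  have hbar : S * K * (1 - (F * K)ᵀ * ((F * K) * (F * K)ᵀ)⁻¹ * (F * K)) * (selM n r)ᵀ
      = S * A := by
    have hFKM : F * K * (selM n r)ᵀ = 0 := by rw [Matrix.mul_assoc, hKM, hFA]
    rw [Matrix.mul_assoc, Matrix.sub_mul, Matrix.one_mul, Matrix.mul_assoc _ (F * K), hFKM,
      Matrix.mul_zero, sub_zero, Matrix.mul_assoc, hKM]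
  rw [hbar]
  constructor
  · rintro ⟨q, hq, hFq, hSq⟩
    have hmem : q.ofLp ∈ LinearMap.range A.mulVecLin := by
      rw [range_mulVecLin]
      exact hspan q hFq
    obtain ⟨x, hx⟩ := hmem
    rw [mulVecLin_apply] at hx
    refine ⟨WithLp.toLp 2 x, ?_, fun i => ?_⟩
    · rw [← norm_toLp_mulVec_of_transpose_mul_self hA, ← hq]
      simp only [hx]
    · rw [← mulVec_mulVec]
      simpa only [hx] using hSq i
  · rintro ⟨x, hx, hSx⟩
    refine ⟨WithLp.toLp 2 (A *ᵥ x), ?_, ?_, fun i => ?_⟩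
    · rw [norm_toLp_mulVec_of_transpose_mul_self hA, hx]
    · simp only [mulVec_mulVec, hFA, zero_mulVec]
    · simpa only [mulVec_mulVec] using hSx i
end

section
/- For any s×m real matrix A with s ≤ m, there exists a unit vector q ∈ ℝᵐ (‖q‖ = 1) such that A q ≥ 0 componentwise. That is, any system of at most m linear sign restrictions in ℝᵐ always has a solution on the unit sphere. -/
open Matrix

/-- A system of at most as many homogeneous linear inequalities as unknowns has a nonzero
solution. -/
theorem Matrix.exists_ne_zero_mulVec_nonneg {ι κ K : Type*} [Fintype ι] [Fintype κ] [Nonempty κ]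
    [Field K] [LinearOrder K] [IsStrictOrderedRing K]
    (h : Fintype.card ι ≤ Fintype.card κ) (A : Matrix ι κ K) :
    ∃ v : κ → K, v ≠ 0 ∧ 0 ≤ A *ᵥ v := by
  by_cases hA : Function.Injective A.mulVecLin
  · have hcard : Fintype.card κ = Fintype.card ι :=
      le_antisymm (by simpa using LinearMap.finrank_le_finrank_of_injective hA) h
    have hsurj : Function.Surjective A.mulVecLin :=
      (LinearMap.injective_iff_surjective_of_finrank_eq_finrank (by simpa using hcard)).1 hA
    obtain ⟨v, hv⟩ := hsurj 1
    rw [mulVecLin_apply] at hv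
    have : Nonempty ι := Fintype.card_pos_iff.1 (hcard ▸ Fintype.card_pos)
    refine ⟨v, ?_, hv ▸ zero_le_one⟩
    rintro rfl
    simp at hv
  · rw [← LinearMap.ker_eq_bot, Submodule.eq_bot_iff] at hA
    push Not at hA
    obtain ⟨v, hv, hv0⟩ := hA
    rw [LinearMap.mem_ker, mulVecLin_apply] at hv
    exact ⟨v, hv0, hv.ge⟩

/-- Any system of at most `m` linear sign restrictions in `ℝᵐ` has a solution on the unit
sphere: for any `s × m` real matrix `A` with `s ≤ m` (and `m ≥ 1`), there is a unit vector
`q ∈ ℝᵐ` with `A q ≥ 0` componentwise. -/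
theorem exists_unit_vector_sign_restrictions (s m : ℕ) (hm : 1 ≤ m) (hsm : s ≤ m)
    (A : Matrix (Fin s) (Fin m) ℝ) :
    ∃ q : EuclideanSpace ℝ (Fin m), ‖q‖ = 1 ∧ ∀ i, 0 ≤ A.mulVec q i := by
  have : Nonempty (Fin m) := ⟨⟨0, hm⟩⟩
  obtain ⟨v, hv0, hv⟩ := A.exists_ne_zero_mulVec_nonneg (by simpa using hsm)
  have hw : WithLp.toLp 2 v ≠ 0 := by simpa using hv0
  refine ⟨‖WithLp.toLp 2 v‖⁻¹ • WithLp.toLp 2 v, norm_smul_inv_norm (𝕜 := ℝ) hw, fun i => ?_⟩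
  rw [WithLp.ofLp_smul, mulVec_smul]
  exact mul_nonneg (inv_nonneg.2 (norm_nonneg _)) (hv i)
end

section
/- Let F be an r×n real matrix with rank r, let S be an s×n real matrix, and suppose r < n and r + s ≤ n. Then the identified set Q₁(F,S) = {q ∈ ℝⁿ : ‖q‖ = 1, F q = 0, S q ≥ 0} is nonempty. That is, when the total number of zero restrictions and sign restrictions does not exceed the dimension n, the identified set is never empty. -/
open Matrix

/-- If `f : V → W` and `g : V → ℝ^ι` are linear with `dim W < dim V` and
`dim W + #ι ≤ dim V`, then some nonzero vector in the kernel of `f` has nonnegative image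
under `g`. -/
theorem LinearMap.exists_ne_zero_map_eq_zero_and_nonneg {V W ι : Type*} [AddCommGroup V]
    [Module ℝ V] [FiniteDimensional ℝ V] [AddCommGroup W] [Module ℝ W] [FiniteDimensional ℝ W]
    [Fintype ι] (f : V →ₗ[ℝ] W) (g : V →ₗ[ℝ] ι → ℝ)
    (hlt : Module.finrank ℝ W < Module.finrank ℝ V)
    (hle : Module.finrank ℝ W + Fintype.card ι ≤ Module.finrank ℝ V) :
    ∃ v, v ≠ 0 ∧ f v = 0 ∧ 0 ≤ g v := by
  have hdim : Module.finrank ℝ (W × (ι → ℝ)) = Module.finrank ℝ W + Fintype.card ι := by simp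
  by_cases hinj : Function.Injective (f.prod g)
  · have hVle := LinearMap.finrank_le_finrank_of_injective hinj
    have hsurj := (LinearMap.injective_iff_surjective_of_finrank_eq_finrank
      (by omega : Module.finrank ℝ V = Module.finrank ℝ (W × (ι → ℝ)))).1 hinj
    have : Nonempty ι := Fintype.card_pos_iff.1 (by omega)
    obtain ⟨v, hv⟩ := hsurj (0, 1)
    have hf : f v = 0 := congrArg Prod.fst hv
    have hg : g v = 1 := congrArg Prod.snd hv
    refine ⟨v, ?_, hf, hg ▸ zero_le_one⟩
    rintro rfl
    simp at hg
  · rw [← LinearMap.ker_eq_bot] at hinj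
    obtain ⟨v, hv, hv0⟩ := Submodule.exists_mem_ne_zero_of_ne_bot hinj
    have hv' : f.prod g v = 0 := hv
    have hf : f v = 0 := congrArg Prod.fst hv'
    have hg : g v = 0 := congrArg Prod.snd hv'
    exact ⟨v, hv0, hf, hg.ge⟩

/-- If `F` is an `r × n` real matrix with full row rank `r`, `S` is an `s × n` real matrix,
`r < n` and `r + s ≤ n`, then the identified set
`Q₁(F,S) = {q ∈ ℝⁿ : ‖q‖ = 1, F q = 0, S q ≥ 0}` is nonempty: when the total number of zero
and sign restrictions does not exceed the dimension, the identified set is never empty. -/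
theorem identified_set_nonempty_of_few_restrictions (n r s : ℕ) (hrn : r < n) (hrs : r + s ≤ n)
    (F : Matrix (Fin r) (Fin n) ℝ) (hF : F.rank = r) (S : Matrix (Fin s) (Fin n) ℝ) :
    ∃ q : EuclideanSpace ℝ (Fin n), ‖q‖ = 1 ∧ F.mulVec q = 0 ∧ ∀ i, 0 ≤ S.mulVec q i := by
  obtain ⟨v, hv0, hFv, hSv⟩ := LinearMap.exists_ne_zero_map_eq_zero_and_nonneg
    F.mulVecLin S.mulVecLin (by simpa using hrn) (by simpa using hrs)
  rw [mulVecLin_apply] at hFv hSv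
  have hq0 : WithLp.toLp 2 v ≠ 0 := by simpa using hv0
  refine ⟨‖WithLp.toLp 2 v‖⁻¹ • WithLp.toLp 2 v, norm_smul_inv_norm hq0, ?_, fun i => ?_⟩
  · simp [mulVec_smul, hFv]
  · simpa [mulVec_smul] using mul_nonneg (inv_nonneg.2 (norm_nonneg (WithLp.toLp 2 v))) (hSv i)
end
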